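/- For every odd integer n ≥ 3, the triples (n² + (n−1)/2, n³ − n, n³ − (n−1)/2) and (n² − (n+1)/2, n³ − n, n³ − (n+1)/2) are Pythagorean triples; their first components differ by n and their second components are equal. -/

import Mathlib

/-- For every odd integer `n ≥ 3`, the triples
`(n² + (n−1)/2, n³ − n, n³ − (n−1)/2)` and `(n² − (n+1)/2, n³ − n, n³ − (n+1)/2)`
are Pythagorean; their first components differ by `n` and their second components
are equal. -/
theorem odd_pythagorean_triples (n : ℤ) (hn : 3 ≤ n) (hodd : Odd n) :
    (n ^ 2 + (n - 1) / 2) ^ 2 + (n ^ 3 - n) ^ 2 = (n ^ 3 - (n - 1) / 2) ^ 2 ∧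
    (n ^ 2 - (n + 1) / 2) ^ 2 + (n ^ 3 - n) ^ 2 = (n ^ 3 - (n + 1) / 2) ^ 2 ∧
    (n ^ 2 + (n - 1) / 2) - (n ^ 2 - (n + 1) / 2) = n ∧
    (n ^ 3 - n : ℤ) = n ^ 3 - n := by
  obtain ⟨k, rfl⟩ := hodd
  have h₁ : (2 * k + 1 - 1) / 2 = k := by lia
  have h₂ : (2 * k + 1 + 1) / 2 = k + 1 := by lia
  rw [h₁, h₂]
  refine ⟨?_, ?_, ?_, rfl⟩ <;> ring
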